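/- (MHGRN expresses K-hop Relation Networks.) Let E ⊆ V × R × V be a multi-relational graph on n nodes with m relation types, let Q, A ⊆ V with A nonempty, let K ≥ 1, and let h̃_v ∈ ℝ^{d_1} (v ∈ V), ẽ_r ∈ ℝ^{d_2} (r ∈ R), W̃_1 ∈ ℝ^{d_3×d_1}, W̃_2 ∈ ℝ^{d_3×d_2}, W̃_3 ∈ ℝ^{d_3×d_1} be arbitrary. For i ∈ V and 1 ≤ k ≤ K let N_{k,i} denote the number of k-hop relational paths (j, r_1, ..., r_k, i) ending at i with j ∈ Q, and assume N_{k,i} ≥ 1 for every i ∈ A and every 1 ≤ k ≤ K. Define the K-hop Relation Network output RN = Σ_{k=1}^{K} Σ over paths (j, r_1, ..., r_k, i) ∈ Φ_k with j ∈ Q and i ∈ A of (1/(K · |A| · N_{k,i})) · (W̃_1 h̃_j + W̃_2 (ẽ_{r_1} ∘ ⋯ ∘ ẽ_{r_k}) + W̃_3 h̃_i). Define the MHGRN computation with the parameter setting: x_v = h̃_v ⊕ 1_{d_2} ∈ ℝ^{d_1+d_2}; W_r = diag(1_{d_1} ⊕ ẽ_r) for r ∈ R; z_i^k = (1/N_{k,i})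 · Σ over paths (j, r_1, ..., r_k, i) ∈ Φ_k with j ∈ Q of W_{r_k} ⋯ W_{r_1} x_j; z_i = (1/K) Σ_{k=1}^{K} z_i^k; and h'_i = W̃_3 h̃_i + [W̃_1, W̃_2] z_i, where [W̃_1, W̃_2] ∈ ℝ^{d_3×(d_1+d_2)} is horizontal block concatenation. Then (1/|A|) · Σ_{i ∈ A} h'_i = RN. -/

import Mathlib

/-- The finite set of `(k+1)`-hop relational paths ending at node `i` whose start node
lies in `Q`: a path is a pair of a node chain `p.1 : Fin (k+2) → Fin n` and a relation
sequence `p.2 : Fin (k+1) → Fin m` with consecutive triples in `E`. -/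
def pathSet (n m : ℕ) (E : Finset (Fin n × Fin m × Fin n)) (Q : Finset (Fin n))
    (k : ℕ) (i : Fin n) :
    Finset ((Fin (k + 2) → Fin n) × (Fin (k + 1) → Fin m)) :=
  Finset.univ.filter fun p =>
    p.1 0 ∈ Q ∧ p.1 (Fin.last (k + 1)) = i ∧
    ∀ t : Fin (k + 1), (p.1 t.castSucc, p.2 t, p.1 t.succ) ∈ E

theorem prod_ofFn_diagonal {ι α : Type*} [Fintype ι] [DecidableEq ι] [CommSemiring α] {k : ℕ}
    (f : Fin k → ι → α) :
    (List.ofFn fun t => Matrix.diagonal (f t)).prod = Matrix.diagonal (∏ t, f t) := by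
  have key := map_list_prod (Matrix.diagonalRingHom ι α) (List.ofFn f)
  rw [List.map_ofFn, List.prod_ofFn] at key
  exact key.symm

theorem mulVec_append {α : Type*} [NonUnitalNonAssocSemiring α] {a b c : ℕ}
    (M : Matrix (Fin c) (Fin (a + b)) α) (M₁ : Matrix (Fin c) (Fin a) α)
    (M₂ : Matrix (Fin c) (Fin b) α) (hM : ∀ i j, M i j = Fin.append (M₁ i) (M₂ i) j)
    (u : Fin a → α) (v : Fin b → α) :
    M.mulVec (Fin.append u v) = M₁.mulVec u + M₂.mulVec v := by
  ext i
  simp [Matrix.mulVec, dotProduct, Fin.sum_univ_add, hM]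

theorem prod_diagonal_append_mulVec {α : Type*} [CommSemiring α] {a b k : ℕ}
    (e : Fin k → Fin b → α) (u : Fin a → α) :
    (List.ofFn fun t : Fin k =>
        Matrix.diagonal (Fin.append (fun _ : Fin a => (1 : α)) (e t.rev))).prod.mulVec
      (Fin.append u fun _ => 1) = Fin.append u fun y => ∏ t, e t y := by
  rw [prod_ofFn_diagonal]
  ext c
  rw [Matrix.mulVec_diagonal, Finset.prod_apply]
  refine Fin.addCases (fun j => ?_) (fun j => ?_) c
  · simp
  · simpa using Equiv.prod_comp Fin.revPerm fun t => e t j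

/-- (MHGRN expresses K-hop Relation Networks.) With the parameter
setting `x_v = h̃_v ⊕ 1_{d2}`, `W_r = diag(1_{d1} ⊕ ẽ_r)`,
`z_i^k = (1/N_{k,i}) Σ_{paths} W_{r_k} ⋯ W_{r_1} x_j`, `z_i = (1/K) Σ_k z_i^k`,
`h'_i = W̃_3 h̃_i + [W̃_1, W̃_2] z_i`, the averaged MHGRN output
`(1/|A|) Σ_{i ∈ A} h'_i` equals the K-hop Relation Network output
`RN = Σ_{k=1}^{K} Σ_{(j,r_1,…,r_k,i) ∈ Φ_k, j ∈ Q, i ∈ A}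
(1/(K·|A|·N_{k,i})) (W̃_1 h̃_j + W̃_2 (ẽ_{r_1} ∘ ⋯ ∘ ẽ_{r_k}) + W̃_3 h̃_i)`.
(Hop counts `k = 1, …, K` are indexed by `k ∈ Finset.range K` with hop count `k + 1`.) -/
theorem stmt_10 (n m d1 d2 d3 : ℕ) (E : Finset (Fin n × Fin m × Fin n))
    (Q Aset : Finset (Fin n)) (hAne : Aset.Nonempty)
    (K : ℕ) (hK : 1 ≤ K)
    (h : Fin n → Fin d1 → ℝ) (e : Fin m → Fin d2 → ℝ)
    (W1 : Matrix (Fin d3) (Fin d1) ℝ) (W2 : Matrix (Fin d3) (Fin d2) ℝ)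
    (W3 : Matrix (Fin d3) (Fin d1) ℝ)
    (hN : ∀ i ∈ Aset, ∀ k ∈ Finset.range K, 1 ≤ (pathSet n m E Q k i).card)
    (x : Fin n → Fin (d1 + d2) → ℝ)
    (hx : ∀ v, x v = Fin.append (h v) (fun _ => (1 : ℝ)))
    (Wmat : Fin m → Matrix (Fin (d1 + d2)) (Fin (d1 + d2)) ℝ)
    (hW : ∀ r, Wmat r = Matrix.diagonal (Fin.append (fun _ => (1 : ℝ)) (e r)))
    (V' : Matrix (Fin d3) (Fin (d1 + d2)) ℝ)
    (hV' : ∀ (a : Fin d3) (c : Fin (d1 + d2)), V' a c = Fin.append (W1 a) (W2 a) c)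
    (zk : Fin n → ℕ → Fin (d1 + d2) → ℝ)
    (hzk : ∀ (i : Fin n) (k : ℕ), zk i k =
      ((pathSet n m E Q k i).card : ℝ)⁻¹ •
        ∑ p ∈ pathSet n m E Q k i,
          (List.ofFn fun t : Fin (k + 1) => Wmat (p.2 t.rev)).prod.mulVec (x (p.1 0)))
    (z : Fin n → Fin (d1 + d2) → ℝ)
    (hz : ∀ i : Fin n, z i = (K : ℝ)⁻¹ • ∑ k ∈ Finset.range K, zk i k)
    (h' : Fin n → Fin d3 → ℝ)
    (hh' : ∀ i : Fin n, h' i = W3.mulVec (h i) + V'.mulVec (z i)) :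
    (Aset.card : ℝ)⁻¹ • ∑ i ∈ Aset, h' i
      = ∑ k ∈ Finset.range K, ∑ i ∈ Aset, ∑ p ∈ pathSet n m E Q k i,
          ((K : ℝ) * (Aset.card : ℝ) * ((pathSet n m E Q k i).card : ℝ))⁻¹ •
            (W1.mulVec (h (p.1 0)) +
              W2.mulVec (fun y => ∏ t : Fin (k + 1), e (p.2 t) y) +
              W3.mulVec (h i)) := by
  have hKne : (K : ℝ) ≠ 0 := by positivity
  have hterm : ∀ i k, V'.mulVec (zk i k) = ((pathSet n m E Q k i).card : ℝ)⁻¹ •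
      ∑ p ∈ pathSet n m E Q k i, (W1.mulVec (h (p.1 0)) +
        W2.mulVec (fun y => ∏ t : Fin (k + 1), e (p.2 t) y)) := by
    intro i k
    rw [hzk, Matrix.mulVec_smul, Matrix.mulVec_sum]
    congr 1
    refine Finset.sum_congr rfl fun p _ => ?_
    simp only [hW, hx]
    rw [prod_diagonal_append_mulVec (fun t => e (p.2 t)), mulVec_append V' W1 W2 hV']
  rw [Finset.sum_comm, Finset.smul_sum]
  refine Finset.sum_congr rfl fun i hi => ?_
  have hsplit : h' i = (K : ℝ)⁻¹ • ∑ k ∈ Finset.range K,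
      (V'.mulVec (zk i k) + W3.mulVec (h i)) := by
    rw [hh', hz, Matrix.mulVec_smul, Matrix.mulVec_sum, Finset.sum_add_distrib,
      Finset.sum_const, Finset.card_range, smul_add, ← Nat.cast_smul_eq_nsmul ℝ,
      inv_smul_smul₀ hKne, add_comm]
  rw [hsplit, smul_smul, Finset.smul_sum]
  refine Finset.sum_congr rfl fun k hk => ?_
  have hNne : ((pathSet n m E Q k i).card : ℝ) ≠ 0 :=
    Nat.cast_ne_zero.mpr (Nat.one_le_iff_ne_zero.mp (hN i hi k hk))
  rw [hterm, ← Finset.smul_sum, Finset.sum_add_distrib (g := fun _ => W3.mulVec (h i)),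
    Finset.sum_const, mul_inv, mul_comm (K : ℝ), mul_inv, mul_smul (_ * _ : ℝ),
    smul_add ((pathSet n m E Q k i).card : ℝ)⁻¹, ← Nat.cast_smul_eq_nsmul ℝ,
    inv_smul_smul₀ hNne]
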